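/- arXiv:1208.2342 — 2 statements merged into one kernel-verified Lean document; each statement's English description precedes it below -/
import Mathlib

section
/- Let v₀, v₁ : Ω → ℝ be twice continuously differentiable and positive on Ω with P v₀ = 0 and P v₁ = 0 on Ω, and set W(x) := ¼ |∇ log(v₁/v₀)(x)|²_{A(x)}. Then for every ξ ∈ ℝ the (oscillatory) function φ(x) := √(v₀(x) v₁(x)) · cos(ξ · log(v₁(x)/v₀(x))) satisfies P φ = (1 + 4ξ²) · W · φ pointwise on Ω. -/
open MeasureTheory Finset

noncomputable section

abbrev Euc (n : ℕ) := EuclideanSpace ℝ (Fin n)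

/-- The `i`-th partial derivative of `u` at `x`. -/
def pd {n : ℕ} (i : Fin n) (u : Euc n → ℝ) (x : Euc n) : ℝ :=
  fderiv ℝ u x (EuclideanSpace.single i 1)

/-- The second partial derivative `∂ᵢ∂ⱼ u` at `x`. -/
def pd2 {n : ℕ} (i j : Fin n) (u : Euc n → ℝ) (x : Euc n) : ℝ :=
  fderiv ℝ (fun y => fderiv ℝ u y (EuclideanSpace.single j 1)) x
    (EuclideanSpace.single i 1)

/-- The quadratic form `|ξ|²_{A(x)} = ξ · (A(x) ξ)`. -/
def quadA {n : ℕ} (A : Euc n → Matrix (Fin n) (Fin n) ℝ) (x : Euc n)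
    (ξ : Fin n → ℝ) : ℝ :=
  ∑ i, ∑ j, ξ i * A x i j * ξ j

/-- The second-order elliptic operator
`(P u)(x) = −∑ᵢⱼ A(x)ᵢⱼ ∂ᵢ∂ⱼu(x) + b(x)·∇u(x) + c(x) u(x)`. -/
def ellOp {n : ℕ} (A : Euc n → Matrix (Fin n) (Fin n) ℝ)
    (b : Euc n → Fin n → ℝ) (c : Euc n → ℝ) (u : Euc n → ℝ) (x : Euc n) : ℝ :=
  -(∑ i, ∑ j, A x i j * pd2 i j u x) + (∑ i, b x i * pd i u x) + c x * u x

open Filter Topology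

section PartialDerivatives

variable {n : ℕ} {f g u v : Euc n → ℝ} {x : Euc n}

lemma pd_congr (h : u =ᶠ[𝓝 x] v) (i : Fin n) : pd i u x = pd i v x := by
  simp only [pd, h.fderiv_eq]

lemma pd2_congr (h : u =ᶠ[𝓝 x] v) (i j : Fin n) : pd2 i j u x = pd2 i j v x :=
  pd_congr (u := pd j u) (v := pd j v) (h.eventuallyEq_nhds.mono fun _ hy => pd_congr hy j) i

lemma ellOp_congr (h : u =ᶠ[𝓝 x] v) (A : Euc n → Matrix (Fin n) (Fin n) ℝ)
    (b : Euc n → Fin n → ℝ) (c : Euc n → ℝ) : ellOp A b c u x = ellOp A b c v x := by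
  simp only [ellOp, pd_congr h, pd2_congr h, h.eq_of_nhds]

lemma differentiableAt_pd (hf : ContDiffAt ℝ 2 f x) (i : Fin n) :
    DifferentiableAt ℝ (pd i f) x := by
  have h : DifferentiableAt ℝ (fderiv ℝ f) x :=
    (hf.fderiv_right (m := 1) (by norm_num)).differentiableAt (by norm_num)
  exact h.clm_apply (differentiableAt_const _)

lemma eventually_differentiableAt (hf : ContDiffAt ℝ 2 f x) :
    ∀ᶠ y in 𝓝 x, DifferentiableAt ℝ f y :=
  (hf.eventually (by simp)).mono fun _ hy => hy.differentiableAt (by norm_num)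

lemma pd_linear_comb (hf : DifferentiableAt ℝ f x) (hg : DifferentiableAt ℝ g x) (r s : ℝ)
    (i : Fin n) : pd i (fun y => r * f y + s * g y) x = r * pd i f x + s * pd i g x := by
  have h := (hf.hasFDerivAt.const_mul r).add (hg.hasFDerivAt.const_mul s)
  exact congrArg (fun L => L (EuclideanSpace.single i 1)) h.fderiv

lemma pd2_linear_comb (hf : ContDiffAt ℝ 2 f x) (hg : ContDiffAt ℝ 2 g x) (r s : ℝ)
    (i j : Fin n) :
    pd2 i j (fun y => r * f y + s * g y) x = r * pd2 i j f x + s * pd2 i j g x := by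
  have h : pd j (fun y => r * f y + s * g y) =ᶠ[𝓝 x] fun y => r * pd j f y + s * pd j g y := by
    filter_upwards [eventually_differentiableAt hf, eventually_differentiableAt hg] with y hy hy'
    exact pd_linear_comb hy hy' r s j
  exact (pd_congr h i).trans
    (pd_linear_comb (differentiableAt_pd hf j) (differentiableAt_pd hg j) r s i)

lemma pd_exp_mul_cos (hf : DifferentiableAt ℝ f x) (hg : DifferentiableAt ℝ g x) (i : Fin n) :
    pd i (fun y => Real.exp (f y) * Real.cos (g y)) x =
      Real.exp (f x) * (Real.cos (g x) * pd i f x - Real.sin (g x) * pd i g x) := by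
  have h := hf.hasFDerivAt.exp.mul hg.hasFDerivAt.cos
  have h' := congrArg (fun L => L (EuclideanSpace.single i 1)) h.fderiv
  simp only [add_apply, smul_apply, smul_eq_mul] at h'
  exact h'.trans (by simp only [pd]; ring)

lemma pd2_exp_mul_cos (hf : ContDiffAt ℝ 2 f x) (hg : ContDiffAt ℝ 2 g x) (i j : Fin n) :
    pd2 i j (fun y => Real.exp (f y) * Real.cos (g y)) x =
      Real.exp (f x) *
        (Real.cos (g x) * (pd i f x * pd j f x + pd2 i j f x - pd i g x * pd j g x) -
          Real.sin (g x) * (pd i f x * pd j g x + pd j f x * pd i g x + pd2 i j g x)) := by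
  have h : pd j (fun y => Real.exp (f y) * Real.cos (g y)) =ᶠ[𝓝 x]
      fun y => Real.exp (f y) * (Real.cos (g y) * pd j f y - Real.sin (g y) * pd j g y) := by
    filter_upwards [eventually_differentiableAt hf, eventually_differentiableAt hg] with y hy hy'
    exact pd_exp_mul_cos hy hy' j
  refine (pd_congr h i).trans ?_
  have hf' := (hf.differentiableAt (by norm_num)).hasFDerivAt
  have hg' := (hg.differentiableAt (by norm_num)).hasFDerivAt
  have hd := hf'.exp.mul ((hg'.cos.mul (differentiableAt_pd hf j).hasFDerivAt).sub
    (hg'.sin.mul (differentiableAt_pd hg j).hasFDerivAt))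
  have hd' := congrArg (fun L => L (EuclideanSpace.single i 1)) hd.fderiv
  simp only [add_apply, sub_apply,
    smul_apply, smul_eq_mul, Pi.mul_apply, Pi.sub_apply] at hd'
  refine hd'.trans ?_
  change _ = Real.exp (f x) *
        (Real.cos (g x) * (pd i f x * pd j f x + pd i (pd j f) x - pd i g x * pd j g x) -
          Real.sin (g x) * (pd i f x * pd j g x + pd j f x * pd i g x + pd i (pd j g) x))
  simp only [pd]
  ring

/-- The conjugated operator `exp (-f) * P (exp f)`, written in terms of `f`. -/
def logEllOp (A : Euc n → Matrix (Fin n) (Fin n) ℝ) (b : Euc n → Fin n → ℝ) (c : Euc n → ℝ)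
    (f : Euc n → ℝ) (x : Euc n) : ℝ :=
  -(∑ i, ∑ j, A x i j * (pd i f x * pd j f x + pd2 i j f x)) + (∑ i, b x i * pd i f x) + c x

lemma ellOp_exp (A : Euc n → Matrix (Fin n) (Fin n) ℝ) (b : Euc n → Fin n → ℝ)
    (c : Euc n → ℝ) (hf : ContDiffAt ℝ 2 f x) :
    ellOp A b c (fun y => Real.exp (f y)) x = Real.exp (f x) * logEllOp A b c f x := by
  have h0 : ContDiffAt ℝ 2 (fun _ : Euc n => (0 : ℝ)) x := contDiffAt_const
  have e1 := fun i => pd_exp_mul_cos (hf.differentiableAt (by norm_num))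
    (h0.differentiableAt (by norm_num)) i
  have e2 := fun i j => pd2_exp_mul_cos hf h0 i j
  simp only [Real.cos_zero, Real.sin_zero, mul_one, one_mul, zero_mul, sub_zero] at e1 e2
  have z : ∀ i, pd i (fun _ : Euc n => (0 : ℝ)) x = 0 := fun i => by simp [pd]
  simp only [ellOp, logEllOp, e1, e2, z, mul_add, mul_neg, Finset.mul_sum, mul_zero, sub_zero]
  congr 1
  · congr 1
    · congr 1
      refine Finset.sum_congr rfl fun i _ => Finset.sum_congr rfl fun j _ => by ring
    · refine Finset.sum_congr rfl fun i _ => by ring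
  · ring

/-- `P` applied to `exp ((f + g) / 2) * cos (ξ * (g - f))`. -/
lemma ellOp_exp_mul_cos (A : Euc n → Matrix (Fin n) (Fin n) ℝ) (b : Euc n → Fin n → ℝ)
    (c : Euc n → ℝ) (hf : ContDiffAt ℝ 2 f x) (hg : ContDiffAt ℝ 2 g x) (ξ : ℝ) :
    ellOp A b c (fun y => Real.exp (1 / 2 * f y + 1 / 2 * g y) *
        Real.cos (ξ * g y + -ξ * f y)) x =
      Real.exp (1 / 2 * f x + 1 / 2 * g x) *
        (Real.cos (ξ * g x + -ξ * f x) *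
            (1 / 2 * logEllOp A b c f x + 1 / 2 * logEllOp A b c g x +
              (1 / 4 + ξ ^ 2) * quadA A x (fun i => pd i g x - pd i f x)) +
          ξ * Real.sin (ξ * g x + -ξ * f x) *
            (logEllOp A b c f x - logEllOp A b c g x)) := by
  have hf' := hf.differentiableAt (by norm_num)
  have hg' := hg.differentiableAt (by norm_num)
  have hs : ContDiffAt ℝ 2 (fun y => 1 / 2 * f y + 1 / 2 * g y) x := by fun_prop
  have hd : ContDiffAt ℝ 2 (fun y => ξ * g y + -ξ * f y) x := by fun_prop
  have e1 := fun i => pd_exp_mul_cos (hs.differentiableAt (by norm_num))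
    (hd.differentiableAt (by norm_num)) i
  have e2 := fun i j => pd2_exp_mul_cos hs hd i j
  simp only [pd_linear_comb hf' hg', pd_linear_comb hg' hf', pd2_linear_comb hf hg,
    pd2_linear_comb hg hf] at e1 e2
  simp only [ellOp, logEllOp, quadA, e1, e2]
  generalize Real.exp (1 / 2 * f x + 1 / 2 * g x) = E
  generalize Real.cos (ξ * g x + -ξ * f x) = C
  generalize Real.sin (ξ * g x + -ξ * f x) = S
  have first : ∑ i, b x i * (E * (C * (1 / 2 * pd i f x + 1 / 2 * pd i g x) -
      S * (ξ * pd i g x + -ξ * pd i f x))) =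
      E * (C / 2 + ξ * S) * (∑ i, b x i * pd i f x) +
        E * (C / 2 - ξ * S) * ∑ i, b x i * pd i g x := by
    simp only [Finset.mul_sum, ← Finset.sum_add_distrib]
    exact Finset.sum_congr rfl fun i _ => by ring
  rw [first]
  have second : ∑ i, ∑ j, A x i j * (E * (C *
      ((1 / 2 * pd i f x + 1 / 2 * pd i g x) * (1 / 2 * pd j f x + 1 / 2 * pd j g x) +
        (1 / 2 * pd2 i j f x + 1 / 2 * pd2 i j g x) -
        (ξ * pd i g x + -ξ * pd i f x) * (ξ * pd j g x + -ξ * pd j f x)) -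
      S * ((1 / 2 * pd i f x + 1 / 2 * pd i g x) * (ξ * pd j g x + -ξ * pd j f x) +
        (1 / 2 * pd j f x + 1 / 2 * pd j g x) * (ξ * pd i g x + -ξ * pd i f x) +
        (ξ * pd2 i j g x + -ξ * pd2 i j f x)))) =
      E * (C / 2 + ξ * S) * (∑ i, ∑ j, A x i j * (pd i f x * pd j f x + pd2 i j f x)) +
        E * (C / 2 - ξ * S) * (∑ i, ∑ j, A x i j * (pd i g x * pd j g x + pd2 i j g x)) -
        E * C * (1 / 4 + ξ ^ 2) *
          ∑ i, ∑ j, (pd i g x - pd i f x) * A x i j * (pd j g x - pd j f x) := by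
    simp only [Finset.mul_sum, ← Finset.sum_add_distrib, ← Finset.sum_sub_distrib]
    exact Finset.sum_congr rfl fun i _ => Finset.sum_congr rfl fun j _ => by ring
  rw [second]
  ring

end PartialDerivatives

theorem stmt4 {n : ℕ} (hn : 1 ≤ n) {Ω : Set (Euc n)} (hΩ : IsOpen Ω)
    (A : Euc n → Matrix (Fin n) (Fin n) ℝ) (hAc : ContinuousOn A Ω)
    (hAs : ∀ x ∈ Ω, (A x).IsSymm) (hAp : ∀ x ∈ Ω, (A x).PosDef)
    (b : Euc n → Fin n → ℝ) (hb : ContinuousOn b Ω)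
    (c : Euc n → ℝ) (hc : ContinuousOn c Ω)
    (v₀ v₁ : Euc n → ℝ)
    (hv₀ : ContDiffOn ℝ 2 v₀ Ω) (hv₁ : ContDiffOn ℝ 2 v₁ Ω)
    (hv₀p : ∀ x ∈ Ω, 0 < v₀ x) (hv₁p : ∀ x ∈ Ω, 0 < v₁ x)
    (hPv₀ : ∀ x ∈ Ω, ellOp A b c v₀ x = 0)
    (hPv₁ : ∀ x ∈ Ω, ellOp A b c v₁ x = 0)
    (W : Euc n → ℝ)
    (hW : ∀ x ∈ Ω, W x =
      (1 / 4) * quadA A x (fun i => pd i (fun y => Real.log (v₁ y / v₀ y)) x)) :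
    ∀ ξ : ℝ, ∀ x ∈ Ω,
      ellOp A b c
        (fun y => Real.sqrt (v₀ y * v₁ y) * Real.cos (ξ * Real.log (v₁ y / v₀ y))) x
        = (1 + 4 * ξ ^ 2) * W x *
            (Real.sqrt (v₀ x * v₁ x) * Real.cos (ξ * Real.log (v₁ x / v₀ x))) := by
  intro ξ x hx
  have hlog : ∀ v : Euc n → ℝ, ContDiffOn ℝ 2 v Ω → (∀ x ∈ Ω, 0 < v x) →
      (∀ x ∈ Ω, ellOp A b c v x = 0) →
      ContDiffAt ℝ 2 (fun y => Real.log (v y)) x ∧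
        logEllOp A b c (fun y => Real.log (v y)) x = 0 := by
    intro v hv hvp hPv
    have hl : ContDiffAt ℝ 2 (fun y => Real.log (v y)) x :=
      (hv.contDiffAt (hΩ.mem_nhds hx)).log (hvp x hx).ne'
    have h : v =ᶠ[𝓝 x] fun y => Real.exp (Real.log (v y)) := by
      filter_upwards [hΩ.mem_nhds hx] with y hy
      exact (Real.exp_log (hvp y hy)).symm
    have h0 := hPv x hx
    rw [ellOp_congr h, ellOp_exp A b c hl] at h0
    exact ⟨hl, (mul_eq_zero.mp h0).resolve_left (Real.exp_pos _).ne'⟩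
  obtain ⟨hp, hp0⟩ := hlog v₀ hv₀ hv₀p hPv₀
  obtain ⟨hq, hq0⟩ := hlog v₁ hv₁ hv₁p hPv₁
  have hphi : ∀ y ∈ Ω, Real.sqrt (v₀ y * v₁ y) * Real.cos (ξ * Real.log (v₁ y / v₀ y)) =
      Real.exp (1 / 2 * Real.log (v₀ y) + 1 / 2 * Real.log (v₁ y)) *
        Real.cos (ξ * Real.log (v₁ y) + -ξ * Real.log (v₀ y)) := by
    intro y hy
    have h0 := hv₀p y hy
    have h1 := hv₁p y hy
    rw [Real.log_div h1.ne' h0.ne', Real.sqrt_eq_rpow, Real.rpow_def_of_pos (mul_pos h0 h1),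
      Real.log_mul h0.ne' h1.ne']
    ring_nf
  have hw : ∀ i, pd i (fun y => Real.log (v₁ y / v₀ y)) x =
      pd i (fun y => Real.log (v₁ y)) x - pd i (fun y => Real.log (v₀ y)) x := by
    intro i
    have h : (fun y => Real.log (v₁ y / v₀ y)) =ᶠ[𝓝 x]
        fun y => 1 * Real.log (v₁ y) + -1 * Real.log (v₀ y) := by
      filter_upwards [hΩ.mem_nhds hx] with y hy
      rw [Real.log_div (hv₁p y hy).ne' (hv₀p y hy).ne']
      ring
    rw [pd_congr h, pd_linear_comb (hq.differentiableAt (by norm_num))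
      (hp.differentiableAt (by norm_num))]
    ring
  rw [ellOp_congr ((hΩ.eventually_mem hx).mono hphi),
    ellOp_exp_mul_cos A b c hp hq, hp0, hq0, hphi x hx, hW x hx]
  simp only [hw]
  ring
end
end

section
/- Let v₀, v₁ : Ω → ℝ be twice continuously differentiable and positive on Ω with P v₀ = 0 and P v₁ = 0 on Ω, and set W(x) := ¼ |∇ log(v₀/v₁)(x)|²_{A(x)}; assume W(x) > 0 for every x ∈ Ω. Then for every μ with 0 ≤ μ < 1 the Rellich-type inequality (1−μ²)² ∫_Ω u(x)² W(x) (v₀(x)/v₁(x))^μ dx ≤ ∫_Ω (P u)(x)² W(x)^{−1} (v₀(x)/v₁(x))^μ dx holds for every u ∈ C_c^∞(Ω). -/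
open MeasureTheory Finset

noncomputable section

/-- The symmetric divergence-form operator
`(P u)(x) = −∑ᵢ ∂ᵢ(∑ⱼ A(x)ᵢⱼ ∂ⱼu)(x) + c(x) u(x)`. -/
def divOp {n : ℕ} (A : Euc n → Matrix (Fin n) (Fin n) ℝ)
    (c : Euc n → ℝ) (u : Euc n → ℝ) (x : Euc n) : ℝ :=
  -(∑ i, pd i (fun y => ∑ j, A y i j * pd j u y) x) + c x * u x

/-- The components of the flux `A ∇u`. -/
def flux {n : ℕ} (A : Euc n → Matrix (Fin n) (Fin n) ℝ) (u : Euc n → ℝ) (i : Fin n)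
    (x : Euc n) : ℝ :=
  ∑ j, A x i j * pd j u x

/-- The vector field whose divergence is the defect in the weighted Hardy-type inequality
associated with the two positive solutions `v₀`, `v₁`. -/
def hardyField {n : ℕ} (A : Euc n → Matrix (Fin n) (Fin n) ℝ) (v₀ v₁ u : Euc n → ℝ) (μ : ℝ)
    (i : Fin n) (x : Euc n) : ℝ :=
  (v₀ x / v₁ x) ^ μ * (-(u x * flux A u i x) +
    1 / 2 * u x ^ 2 * (flux A v₀ i x / v₀ x + flux A v₁ i x / v₁ x))

section Calculus

variable {n : ℕ} {x : Euc n} {f : Euc n → ℝ}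

theorem hasDerivAt_pd (i : Fin n) (hf : DifferentiableAt ℝ f x) :
    HasDerivAt (fun t : ℝ => f (x + t • EuclideanSpace.single i 1)) (pd i f x) 0 :=
  hf.hasFDerivAt.hasLineDerivAt _

theorem pd_eq_of_hasDerivAt {i : Fin n} {f' : ℝ} (hf : DifferentiableAt ℝ f x)
    (h : HasDerivAt (fun t : ℝ => f (x + t • EuclideanSpace.single i 1)) f' 0) :
    pd i f x = f' :=
  (hasDerivAt_pd i hf).unique h

theorem contDiffAt_pd {k m : WithTop ℕ∞} (i : Fin n) (hf : ContDiffAt ℝ m f x) (hkm : k + 1 ≤ m) :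
    ContDiffAt ℝ k (pd i f) x :=
  (hf.fderiv_right hkm).clm_apply contDiffAt_const

theorem pd_eq_zero_of_notMem_tsupport (i : Fin n) (hx : x ∉ tsupport f) : pd i f x = 0 := by
  have h : fderiv ℝ f x = 0 := image_eq_zero_of_notMem_tsupport
    fun h => hx (tsupport_fderiv_subset ℝ h)
  simp [pd, h]

theorem contDiffAt_flux {A : Euc n → Matrix (Fin n) (Fin n) ℝ} (i : Fin n)
    (hA : ∀ i j, ContDiffAt ℝ 1 (fun x => A x i j) x) (hf : ContDiffAt ℝ 2 f x) :
    ContDiffAt ℝ 1 (flux A f i) x :=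
  ContDiffAt.sum fun j _ => (hA i j).mul (contDiffAt_pd j hf (by norm_num))

theorem flux_eq_zero_of_notMem_tsupport (A : Euc n → Matrix (Fin n) (Fin n) ℝ) (i : Fin n)
    (hx : x ∉ tsupport f) : flux A f i x = 0 :=
  Finset.sum_eq_zero fun j _ => by rw [pd_eq_zero_of_notMem_tsupport j hx, mul_zero]

theorem divOp_eq (A : Euc n → Matrix (Fin n) (Fin n) ℝ) (c : Euc n → ℝ) (f : Euc n → ℝ)
    (x : Euc n) : divOp A c f x = -(∑ i, pd i (flux A f i) x) + c x * f x := rfl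

theorem divOp_eq_zero_of_notMem_tsupport (A : Euc n → Matrix (Fin n) (Fin n) ℝ) (c : Euc n → ℝ)
    (hx : x ∉ tsupport f) : divOp A c f x = 0 := by
  have h (i : Fin n) : pd i (flux A f i) x = 0 := by
    refine pd_eq_zero_of_notMem_tsupport i fun h => hx ?_
    refine closure_minimal (fun y hy => ?_) (isClosed_tsupport f) h
    by_contra hyf
    exact hy (flux_eq_zero_of_notMem_tsupport A i hyf)
  simp [divOp_eq, h, image_eq_zero_of_notMem_tsupport hx]

theorem pd_log_div {v₀ v₁ : Euc n → ℝ} (i : Fin n) (h₀ : DifferentiableAt ℝ v₀ x)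
    (h₁ : DifferentiableAt ℝ v₁ x) (hp₀ : 0 < v₀ x) (hp₁ : 0 < v₁ x) :
    pd i (fun y => Real.log (v₀ y / v₁ y)) x = pd i v₀ x / v₀ x - pd i v₁ x / v₁ x := by
  have h : DifferentiableAt ℝ (fun y => v₀ y / v₁ y) x := by
    simpa only [div_eq_mul_inv] using h₀.fun_mul (h₁.fun_inv hp₁.ne')
  refine pd_eq_of_hasDerivAt (h.log (div_pos hp₀ hp₁).ne') ?_
  have H := ((hasDerivAt_pd i h₀).div (hasDerivAt_pd i h₁) (by simpa using hp₁.ne')).log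
    (by simpa using ⟨hp₀.ne', hp₁.ne'⟩)
  refine H.congr_deriv ?_
  simp only [Pi.div_apply, zero_smul, add_zero]
  field_simp

theorem contDiffAt_hardyField {A : Euc n → Matrix (Fin n) (Fin n) ℝ} {v₀ v₁ u : Euc n → ℝ}
    (μ : ℝ) (i : Fin n) (hA : ∀ i j, ContDiffAt ℝ 1 (fun x => A x i j) x)
    (h₀ : ContDiffAt ℝ 2 v₀ x) (h₁ : ContDiffAt ℝ 2 v₁ x) (hu : ContDiffAt ℝ 2 u x)
    (hp₀ : 0 < v₀ x) (hp₁ : 0 < v₁ x) :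
    ContDiffAt ℝ 1 (hardyField A v₀ v₁ u μ i) x := by
  have h12 : (1 : WithTop ℕ∞) ≤ 2 := by norm_num
  have k₀ := h₀.of_le h12
  have k₁ := h₁.of_le h12
  have ku := hu.of_le h12
  exact ((k₀.div k₁ hp₁.ne').rpow_const_of_ne (div_pos hp₀ hp₁).ne').mul
    ((ku.mul (contDiffAt_flux i hA hu)).neg.add ((contDiffAt_const.mul (ku.pow 2)).mul
      (((contDiffAt_flux i hA h₀).div k₀ hp₀.ne').add ((contDiffAt_flux i hA h₁).div k₁ hp₁.ne'))))

theorem pd_hardyField {A : Euc n → Matrix (Fin n) (Fin n) ℝ} {v₀ v₁ u : Euc n → ℝ}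
    (μ : ℝ) (i : Fin n) (hA : ∀ i j, ContDiffAt ℝ 1 (fun x => A x i j) x)
    (h₀ : ContDiffAt ℝ 2 v₀ x) (h₁ : ContDiffAt ℝ 2 v₁ x) (hu : ContDiffAt ℝ 2 u x)
    (hp₀ : 0 < v₀ x) (hp₁ : 0 < v₁ x) :
    pd i (hardyField A v₀ v₁ u μ i) x = (v₀ x / v₁ x) ^ μ *
      (μ * (pd i v₀ x / v₀ x - pd i v₁ x / v₁ x) * (-(u x * flux A u i x) +
          1 / 2 * u x ^ 2 * (flux A v₀ i x / v₀ x + flux A v₁ i x / v₁ x))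
        - pd i u x * flux A u i x - u x * pd i (flux A u i) x
        + u x * pd i u x * (flux A v₀ i x / v₀ x + flux A v₁ i x / v₁ x)
        + 1 / 2 * u x ^ 2 * (pd i (flux A v₀ i) x / v₀ x + pd i (flux A v₁ i) x / v₁ x
          - pd i v₀ x / v₀ x * (flux A v₀ i x / v₀ x)
          - pd i v₁ x / v₁ x * (flux A v₁ i x / v₁ x))) := by
  refine pd_eq_of_hasDerivAt
    ((contDiffAt_hardyField μ i hA h₀ h₁ hu hp₀ hp₁).differentiableAt one_ne_zero) ?_
  have d {f : Euc n → ℝ} (hf : ContDiffAt ℝ 2 f x) :=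
    hasDerivAt_pd i (hf.differentiableAt two_ne_zero)
  have dF {f : Euc n → ℝ} (hf : ContDiffAt ℝ 2 f x) :=
    hasDerivAt_pd i ((contDiffAt_flux i hA hf).differentiableAt one_ne_zero)
  have n₀ : v₀ (x + (0 : ℝ) • EuclideanSpace.single i 1) ≠ 0 := by simpa using hp₀.ne'
  have n₁ : v₁ (x + (0 : ℝ) • EuclideanSpace.single i 1) ≠ 0 := by simpa using hp₁.ne'
  have H := (((d h₀).div (d h₁) n₁).rpow_const (p := μ) (Or.inl (div_ne_zero n₀ n₁))).mul
    (((d hu).mul (dF hu)).neg.add (((hasDerivAt_const (0 : ℝ) (1 / 2 : ℝ)).mul ((d hu).pow 2)).mul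
      (((dF h₀).div (d h₀) n₀).add ((dF h₁).div (d h₁) n₁))))
  refine H.congr_deriv ?_
  simp only [Pi.div_apply, Pi.mul_apply, Pi.add_apply, Pi.neg_apply, Pi.pow_apply,
    zero_smul, add_zero]
  rw [Real.rpow_sub_one (div_pos hp₀ hp₁).ne']
  field_simp
  ring

end Calculus

section Algebra

variable {n : ℕ}

theorem quadA_nonneg {A : Euc n → Matrix (Fin n) (Fin n) ℝ} {x : Euc n} (hA : (A x).PosDef)
    (ξ : Fin n → ℝ) : 0 ≤ quadA A x ξ := by
  have h := hA.posSemidef.dotProduct_mulVec_nonneg ξ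
  simpa [quadA, dotProduct, Matrix.mulVec, Finset.mul_sum, mul_assoc] using h

theorem sum_pd_mul_flux_comm {A : Euc n → Matrix (Fin n) (Fin n) ℝ} {x : Euc n}
    (hA : (A x).IsSymm) (f g : Euc n → ℝ) :
    ∑ i, pd i f x * flux A g i x = ∑ i, pd i g x * flux A f i x := by
  simp only [flux, Finset.mul_sum]
  rw [Finset.sum_comm]
  refine Finset.sum_congr rfl fun i _ => Finset.sum_congr rfl fun j _ => ?_
  rw [hA.apply i j]
  ring

theorem quadA_linearCombination {A : Euc n → Matrix (Fin n) (Fin n) ℝ} {x : Euc n}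
    (hA : (A x).IsSymm) (f g h : Euc n → ℝ) (α β γ : ℝ) :
    quadA A x (fun i => α * pd i f x + β * pd i g x + γ * pd i h x) =
      α ^ 2 * ∑ i, pd i f x * flux A f i x + β ^ 2 * ∑ i, pd i g x * flux A g i x
        + γ ^ 2 * ∑ i, pd i h x * flux A h i x
        + 2 * α * β * ∑ i, pd i f x * flux A g i x + 2 * α * γ * ∑ i, pd i f x * flux A h i x
        + 2 * β * γ * ∑ i, pd i g x * flux A h i x := by
  have key (i : Fin n) : ∑ j, (α * pd i f x + β * pd i g x + γ * pd i h x) * A x i j *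
      (α * pd j f x + β * pd j g x + γ * pd j h x) =
      α ^ 2 * (pd i f x * flux A f i x) + β ^ 2 * (pd i g x * flux A g i x)
        + γ ^ 2 * (pd i h x * flux A h i x)
        + α * β * (pd i f x * flux A g i x) + α * β * (pd i g x * flux A f i x)
        + α * γ * (pd i f x * flux A h i x) + α * γ * (pd i h x * flux A f i x)
        + β * γ * (pd i g x * flux A h i x) + β * γ * (pd i h x * flux A g i x) := by
    simp only [flux, Finset.mul_sum, ← Finset.sum_add_distrib]
    exact Finset.sum_congr rfl fun j _ => by ring
  simp only [quadA, key, Finset.sum_add_distrib, ← Finset.mul_sum]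
  rw [sum_pd_mul_flux_comm hA g f, sum_pd_mul_flux_comm hA h f, sum_pd_mul_flux_comm hA h g]
  ring

end Algebra

/-- The Picone-type identity behind the weighted Hardy inequality. -/
theorem sum_pd_hardyField {n : ℕ} {A : Euc n → Matrix (Fin n) (Fin n) ℝ} {c : Euc n → ℝ}
    {v₀ v₁ u : Euc n → ℝ} {x : Euc n} (μ : ℝ)
    (hA : ∀ i j, ContDiffAt ℝ 1 (fun x => A x i j) x) (hAs : (A x).IsSymm)
    (h₀ : ContDiffAt ℝ 2 v₀ x) (h₁ : ContDiffAt ℝ 2 v₁ x) (hu : ContDiffAt ℝ 2 u x)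
    (hp₀ : 0 < v₀ x) (hp₁ : 0 < v₁ x)
    (hP₀ : divOp A c v₀ x = 0) (hP₁ : divOp A c v₁ x = 0) :
    ∑ i, pd i (hardyField A v₀ v₁ u μ i) x = (v₀ x / v₁ x) ^ μ *
      (u x * divOp A c u x - (1 - μ ^ 2) * u x ^ 2 *
          (1 / 4 * quadA A x (fun i => pd i (fun y => Real.log (v₀ y / v₁ y)) x))
        - quadA A x (fun i => 1 * pd i u x + -(u x * ((1 - μ) / 2) / v₀ x) * pd i v₀ x
          + -(u x * ((1 + μ) / 2) / v₁ x) * pd i v₁ x)) := by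
  have hlog : (fun i => pd i (fun y => Real.log (v₀ y / v₁ y)) x) = fun i =>
      0 * pd i u x + (v₀ x)⁻¹ * pd i v₀ x + -(v₁ x)⁻¹ * pd i v₁ x := by
    funext i
    rw [pd_log_div i (h₀.differentiableAt two_ne_zero) (h₁.differentiableAt two_ne_zero) hp₀ hp₁]
    ring
  rw [hlog, quadA_linearCombination hAs, quadA_linearCombination hAs]
  have key (i : Fin n) : pd i (hardyField A v₀ v₁ u μ i) x = (v₀ x / v₁ x) ^ μ * (
      (-1) * (pd i u x * flux A u i x)
      + -(μ * u x / v₀ x) * (pd i v₀ x * flux A u i x)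
      + (μ * u x / v₁ x) * (pd i v₁ x * flux A u i x)
      + (u x / v₀ x) * (pd i u x * flux A v₀ i x)
      + (u x / v₁ x) * (pd i u x * flux A v₁ i x)
      + ((μ - 1) / 2 * u x ^ 2 / v₀ x ^ 2) * (pd i v₀ x * flux A v₀ i x)
      + -((μ + 1) / 2 * u x ^ 2 / v₁ x ^ 2) * (pd i v₁ x * flux A v₁ i x)
      + (μ / 2 * u x ^ 2 / (v₀ x * v₁ x)) * (pd i v₀ x * flux A v₁ i x)
      + -(μ / 2 * u x ^ 2 / (v₀ x * v₁ x)) * (pd i v₁ x * flux A v₀ i x)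
      + -(u x) * pd i (flux A u i) x
      + (1 / 2 * u x ^ 2 / v₀ x) * pd i (flux A v₀ i) x
      + (1 / 2 * u x ^ 2 / v₁ x) * pd i (flux A v₁ i) x) := by
    rw [pd_hardyField μ i hA h₀ h₁ hu hp₀ hp₁]
    field_simp
    ring
  have e₀ : ∑ i, pd i (flux A v₀ i) x = c x * v₀ x := by rw [divOp_eq] at hP₀; linarith
  have e₁ : ∑ i, pd i (flux A v₁ i) x = c x * v₁ x := by rw [divOp_eq] at hP₁; linarith
  have eu : ∑ i, pd i (flux A u i) x = c x * u x - divOp A c u x := by rw [divOp_eq]; ring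
  simp only [key, ← Finset.mul_sum, Finset.sum_add_distrib]
  rw [e₀, e₁, eu, sum_pd_mul_flux_comm hAs v₀ u, sum_pd_mul_flux_comm hAs v₁ u,
    sum_pd_mul_flux_comm hAs v₁ v₀]
  congr 1
  field_simp
  ring

theorem continuous_pd {n : ℕ} {f : Euc n → ℝ} (i : Fin n) (hf : ContDiff ℝ 1 f) :
    Continuous (pd i f) :=
  (hf.continuous_fderiv one_ne_zero).clm_apply continuous_const

theorem hasCompactSupport_pd {n : ℕ} {f : Euc n → ℝ} (i : Fin n) (hf : HasCompactSupport f) :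
    HasCompactSupport (pd i f) :=
  hf.fderiv_apply ℝ _

theorem integral_pd_eq_zero {n : ℕ} {f : Euc n → ℝ} (i : Fin n) (hf : ContDiff ℝ 1 f)
    (hs : HasCompactSupport f) : ∫ x, pd i f x = 0 := by
  have hi : Integrable f := hf.continuous.integrable_of_hasCompactSupport hs
  have hi' : Integrable (fun x => fderiv ℝ f x (EuclideanSpace.single i 1)) :=
    (continuous_pd i hf).integrable_of_hasCompactSupport (hasCompactSupport_pd i hs)
  have h := integral_mul_fderiv_eq_neg_fderiv_mul_of_integrable (μ := volume)
    (f := fun _ : Euc n => (1 : ℝ)) (g := f) (v := EuclideanSpace.single i 1) (by simp)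
    (by simpa using hi') (by simpa using hi)
    (fun _ _ => differentiableAt_const _) (fun x _ => hf.differentiable one_ne_zero x)
  simpa [pd] using h

theorem integrableOn_of_continuousOn_of_eq_zero {n : ℕ} {Ω K : Set (Euc n)} {f : Euc n → ℝ}
    (hΩ : IsOpen Ω) (hK : IsCompact K) (hKΩ : K ⊆ Ω) (hf : ContinuousOn f Ω)
    (h0 : ∀ x, x ∉ K → f x = 0) : IntegrableOn f Ω :=
  ((hf.mono hKΩ).integrableOn_compact hK).of_forall_sdiff_eq_zero hΩ.measurableSet
    fun x hx => h0 x hx.2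

theorem stmt6 {n : ℕ} (hn : 1 ≤ n) {Ω : Set (Euc n)} (hΩ : IsOpen Ω)
    (A : Euc n → Matrix (Fin n) (Fin n) ℝ)
    (hAc : ∀ i j, ContDiffOn ℝ 1 (fun x => A x i j) Ω)
    (hAs : ∀ x ∈ Ω, (A x).IsSymm) (hAp : ∀ x ∈ Ω, (A x).PosDef)
    (c : Euc n → ℝ) (hc : ContinuousOn c Ω)
    (v₀ v₁ : Euc n → ℝ)
    (hv₀ : ContDiffOn ℝ 2 v₀ Ω) (hv₁ : ContDiffOn ℝ 2 v₁ Ω)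
    (hv₀p : ∀ x ∈ Ω, 0 < v₀ x) (hv₁p : ∀ x ∈ Ω, 0 < v₁ x)
    (hPv₀ : ∀ x ∈ Ω, divOp A c v₀ x = 0)
    (hPv₁ : ∀ x ∈ Ω, divOp A c v₁ x = 0)
    (W : Euc n → ℝ)
    (hW : ∀ x ∈ Ω, W x =
      (1 / 4) * quadA A x (fun i => pd i (fun y => Real.log (v₀ y / v₁ y)) x))
    (hWpos : ∀ x ∈ Ω, 0 < W x) :
    ∀ μ : ℝ, 0 ≤ μ → μ < 1 →
      ∀ u : Euc n → ℝ, ContDiff ℝ (⊤ : ℕ∞) u → HasCompactSupport u → tsupport u ⊆ Ω →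
        (1 - μ ^ 2) ^ 2 * ∫ x in Ω, u x ^ 2 * W x * (v₀ x / v₁ x) ^ μ ≤
          ∫ x in Ω, divOp A c u x ^ 2 * (W x)⁻¹ * (v₀ x / v₁ x) ^ μ := by
  intro μ hμ0 hμ1 u hu hus huΩ
  have hu2 : ContDiff ℝ 2 u := hu.of_le (WithTop.coe_le_coe.2 le_top)
  have cA (x) (hx : x ∈ Ω) i j : ContDiffAt ℝ 1 (fun x => A x i j) x :=
    (hAc i j).contDiffAt (hΩ.mem_nhds hx)
  have c₀ (x) (hx : x ∈ Ω) : ContDiffAt ℝ 2 v₀ x := hv₀.contDiffAt (hΩ.mem_nhds hx)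
  have c₁ (x) (hx : x ∈ Ω) : ContDiffAt ℝ 2 v₁ x := hv₁.contDiffAt (hΩ.mem_nhds hx)
  set Φ := hardyField A v₀ v₁ u μ with hΦ
  have hΦ0 (i) (x) (hx : x ∉ tsupport u) : Φ i x = 0 := by
    simp [hΦ, hardyField, image_eq_zero_of_notMem_tsupport hx]
  have hΦt (i) : tsupport (Φ i) ⊆ tsupport u :=
    closure_minimal (fun x hx => by_contra fun h => hx (hΦ0 i x h)) (isClosed_tsupport u)
  have hΦc (i) : ContDiff ℝ 1 (Φ i) := by
    refine contDiff_iff_contDiffAt.2 fun x => ?_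
    by_cases hx : x ∈ tsupport u
    · replace hx := huΩ hx
      exact contDiffAt_hardyField μ i (cA x hx) (c₀ x hx) (c₁ x hx) hu2.contDiffAt (hv₀p x hx)
        (hv₁p x hx)
    · exact contDiffAt_const.congr_of_eventuallyEq
        (notMem_tsupport_iff_eventuallyEq.1 fun h => hx (hΦt i h))
  have hΦs (i) : HasCompactSupport (Φ i) := hus.of_isClosed_subset (isClosed_tsupport _) (hΦt i)
  have hΦi (i) : Integrable (pd i (Φ i)) :=
    (continuous_pd i (hΦc i)).integrable_of_hasCompactSupport (hasCompactSupport_pd i (hΦs i))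
  have hdiv : ∫ x in Ω, ∑ i, pd i (Φ i) x = 0 := by
    rw [setIntegral_eq_integral_of_forall_compl_eq_zero, integral_finsetSum _ fun i _ => hΦi i]
    · exact Finset.sum_eq_zero fun i _ => integral_pd_eq_zero i (hΦc i) (hΦs i)
    · exact fun x hx => Finset.sum_eq_zero fun i _ =>
        pd_eq_zero_of_notMem_tsupport i fun h => hx (huΩ (hΦt i h))
  have hψ : ContinuousOn (fun x => (v₀ x / v₁ x) ^ μ) Ω :=
    (hv₀.continuousOn.div hv₁.continuousOn fun x hx => (hv₁p x hx).ne').rpow_const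
      fun x hx => Or.inl (div_pos (hv₀p x hx) (hv₁p x hx)).ne'
  have hWc : ContinuousOn W Ω := by
    have hl (i) : ContinuousOn (pd i fun y => Real.log (v₀ y / v₁ y)) Ω := fun x hx =>
      (contDiffAt_pd (k := 1) i (((c₀ x hx).div (c₁ x hx) (hv₁p x hx).ne').log
        (div_pos (hv₀p x hx) (hv₁p x hx)).ne') (by norm_num)).continuousAt.continuousWithinAt
    refine ContinuousOn.congr ?_ hW
    exact continuousOn_const.mul (continuousOn_finsetSum _ fun i _ => continuousOn_finsetSum _
      fun j _ => ((hl i).mul (hAc i j).continuousOn).mul (hl j))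
  have hPc : ContinuousOn (divOp A c u) Ω := by
    refine ContinuousOn.add (ContinuousOn.neg (continuousOn_finsetSum _ fun i _ x hx => ?_))
      (hc.mul hu.continuous.continuousOn)
    exact (contDiffAt_pd (k := 0) i (contDiffAt_flux i (cA x hx) hu2.contDiffAt)
      (by norm_num)).continuousAt.continuousWithinAt
  have hI₁ : IntegrableOn (fun x => u x ^ 2 * W x * (v₀ x / v₁ x) ^ μ) Ω :=
    integrableOn_of_continuousOn_of_eq_zero hΩ hus huΩ
      (((hu.continuous.continuousOn.pow 2).mul hWc).mul hψ)
      fun x hx => by simp [image_eq_zero_of_notMem_tsupport hx]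
  have hI₂ : IntegrableOn (fun x => divOp A c u x ^ 2 * (W x)⁻¹ * (v₀ x / v₁ x) ^ μ) Ω :=
    integrableOn_of_continuousOn_of_eq_zero hΩ hus huΩ
      (((hPc.pow 2).mul (hWc.inv₀ fun x hx => (hWpos x hx).ne')).mul hψ)
      fun x hx => by simp [divOp_eq_zero_of_notMem_tsupport A c hx]
  have hI₃ : IntegrableOn (fun x => ∑ i, pd i (Φ i) x) Ω :=
    (integrable_finsetSum _ fun i _ => hΦi i).integrableOn
  have hC : 0 ≤ 1 - μ ^ 2 := by nlinarith
  calc (1 - μ ^ 2) ^ 2 * ∫ x in Ω, u x ^ 2 * W x * (v₀ x / v₁ x) ^ μ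
      = ∫ x in Ω, ((1 - μ ^ 2) ^ 2 * (u x ^ 2 * W x * (v₀ x / v₁ x) ^ μ)
          + 2 * (1 - μ ^ 2) * ∑ i, pd i (Φ i) x) := by
        rw [integral_add (hI₁.const_mul _) (hI₃.const_mul _), integral_const_mul,
          integral_const_mul, hdiv, mul_zero, add_zero]
    _ ≤ ∫ x in Ω, divOp A c u x ^ 2 * (W x)⁻¹ * (v₀ x / v₁ x) ^ μ := by
        refine setIntegral_mono_on ((hI₁.const_mul _).add (hI₃.const_mul _)) hI₂
          hΩ.measurableSet fun x hx => ?_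
        have hWx := hWpos x hx
        rw [hΦ, sum_pd_hardyField μ (cA x hx) (hAs x hx) (c₀ x hx) (c₁ x hx) hu2.contDiffAt
          (hv₀p x hx) (hv₁p x hx) (hPv₀ x hx) (hPv₁ x hx), ← hW x hx]
        have hq := mul_nonneg hC (quadA_nonneg (hAp x hx) fun i => 1 * pd i u x +
          -(u x * ((1 - μ) / 2) / v₀ x) * pd i v₀ x + -(u x * ((1 + μ) / 2) / v₁ x) * pd i v₁ x)
        set q := quadA A x _
        have hsq : 0 ≤ (divOp A c u x - (1 - μ ^ 2) * u x * W x) ^ 2 * (W x)⁻¹ := by positivity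
        have hsq' : (divOp A c u x - (1 - μ ^ 2) * u x * W x) ^ 2 * (W x)⁻¹ =
            divOp A c u x ^ 2 * (W x)⁻¹ - 2 * (1 - μ ^ 2) * (u x * divOp A c u x)
              + (1 - μ ^ 2) ^ 2 * (u x ^ 2 * W x) := by
          field_simp
          ring
        have hψ0 : 0 ≤ (v₀ x / v₁ x) ^ μ :=
          Real.rpow_nonneg (div_pos (hv₀p x hx) (hv₁p x hx)).le _
        linarith [mul_nonneg hψ0 (add_nonneg (hsq'.symm ▸ hsq) (add_nonneg hq hq))]
end
end
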